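/- arXiv:1309.4022 — 2 statements merged into one kernel-verified Lean document; each statement's English description precedes it below -/
import Mathlib

section
/- For every real constant a > 0 there exists a constant c > 0 such that the following holds: for every graph G and every integer k ≥ 2 with |V(G)| ≤ a·k³, there exists a family 𝒞 of subsets of V(G) with |𝒞| ≤ 2^{c·√k·log k} such that every vital potential maximal clique of (G,k) belongs to 𝒞. -/
open SimpleGraph

universe u

/-- A graph is *trivially perfect* if it has no induced subgraph isomorphic to `C₄` or `P₄`. -/
def TriviallyPerfect {V : Type u} (G : SimpleGraph V) : Prop :=
  IsEmpty (SimpleGraph.cycleGraph 4 ↪g G) ∧ IsEmpty (SimpleGraph.pathGraph 4 ↪g G)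

/-- A *universal clique decomposition* of a graph `G`: a finite rooted tree (modelled as a
finite partial order in which the set of elements above any element is a chain and which has
a top element, the root) together with a partition of the vertices into nonempty bags such that
adjacent vertices lie in comparable nodes, and each bag is exactly the set of universal
vertices of the subgraph induced by the union of the bags in the subtree below it. -/
structure UCD {V : Type u} (G : SimpleGraph V) : Type (u + 1) where
  ι : Type u
  [po : PartialOrder ι]
  [ot : OrderTop ι]
  [fin : Fintype ι]
  bag : ι → Set V
  bag_nonempty : ∀ t, (bag t).Nonempty
  bag_disjoint : ∀ s t, s ≠ t → Disjoint (bag s) (bag t)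
  bag_cover : ∀ v, ∃ t, v ∈ bag t
  up_chain : ∀ a b c : ι, a ≤ b → a ≤ c → b ≤ c ∨ c ≤ b
  adj_comparable : ∀ v w s t, G.Adj v w → v ∈ bag t → w ∈ bag s → s ≤ t ∨ t ≤ s
  bag_eq_universal : ∀ t, bag t =
    {v | (∃ s ≤ t, v ∈ bag s) ∧ ∀ w, (∃ s ≤ t, w ∈ bag s) → w ≠ v → G.Adj v w}

attribute [instance] UCD.po UCD.ot UCD.fin

namespace UCD

variable {V : Type u} {G : SimpleGraph V} (U : UCD G)

/-- `D_t`: the union of the bags in the subtree rooted at `t`. -/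
def subtreeSet (t : U.ι) : Set V := {v | ∃ s, s ≤ t ∧ v ∈ U.bag s}

/-- `Q_t`: the union of the bags on the path from `t` to the root. -/
def tailSet (t : U.ι) : Set V := {v | ∃ s, t ≤ s ∧ v ∈ U.bag s}

/-- `t` is a leaf of the decomposition tree. -/
def IsLeaf (t : U.ι) : Prop := ∀ s : U.ι, s ≤ t → s = t

end UCD

/-- `G + S`: the graph obtained from `G` by adding the pairs in `S` as edges. -/
def completes {V : Type u} (G : SimpleGraph V) (S : Set (Sym2 V)) : SimpleGraph V :=
  G ⊔ SimpleGraph.fromEdgeSet S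

/-- `S` is a set of non-edges of `G` (unordered pairs of distinct vertices, none an edge). -/
def IsCompletionSet {V : Type u} (G : SimpleGraph V) (S : Set (Sym2 V)) : Prop :=
  (∀ e ∈ S, ¬ e.IsDiag) ∧ Disjoint S G.edgeSet

/-- `S` is a minimal trivially perfect completion of `G`. -/
def IsMinTPCompletion {V : Type u} (G : SimpleGraph V) (S : Set (Sym2 V)) : Prop :=
  IsCompletionSet G S ∧ TriviallyPerfect (completes G S) ∧
    ∀ S' ⊂ S, ¬ TriviallyPerfect (completes G S')

/-- A vital potential maximal clique of `(G, k)`. -/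
def VitalPMC {V : Type u} (G : SimpleGraph V) (k : ℕ) (Ω : Set V) : Prop :=
  ∃ S, IsMinTPCompletion G S ∧ S.ncard ≤ k ∧ Maximal (completes G S).IsClique Ω

/-- The closed neighbourhood of a vertex. -/
def closedNbhd {V : Type u} (H : SimpleGraph V) (x : V) : Set V := {y | y = x ∨ H.Adj x y}

section Nested

variable {V : Type u} {H : SimpleGraph V}

theorem mem_closedNbhd_comm {x y : V} : y ∈ closedNbhd H x ↔ x ∈ closedNbhd H y := by
  simp only [closedNbhd, Set.mem_ofPred_eq, H.adj_comm x y, eq_comm]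

theorem self_mem_closedNbhd (x : V) : x ∈ closedNbhd H x := Or.inl rfl

/-- The closed neighbourhoods of adjacent vertices are comparable. -/
def NestedNbhds (H : SimpleGraph V) : Prop :=
  ∀ x y, H.Adj x y → closedNbhd H x ⊆ closedNbhd H y ∨ closedNbhd H y ⊆ closedNbhd H x

theorem TriviallyPerfect.nestedNbhds (h : TriviallyPerfect H) : NestedNbhds H := by
  intro x y hxy
  by_contra! hcon
  obtain ⟨h1, h2⟩ := hcon
  obtain ⟨p, hpx, hpy⟩ := Set.not_subset.1 h1
  obtain ⟨q, hqy, hqx⟩ := Set.not_subset.1 h2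
  simp only [closedNbhd, Set.mem_ofPred_eq, not_or] at hpx hpy hqy hqx
  have hxp : H.Adj x p := by
    rcases hpx with rfl | hpx
    · exact absurd hxy.symm hpy.2
    · exact hpx
  have hyq : H.Adj y q := by
    rcases hqy with rfl | hqy
    · exact absurd hxy hqx.2
    · exact hqy
  have hpq : p ≠ q := by
    rintro rfl
    exact hqx.2 hxp
  have hyp := hpy.2
  have hxq := hqx.2
  have hpy' : ¬ H.Adj p y := fun h => hyp h.symm
  have hqx' : ¬ H.Adj q x := fun h => hxq h.symm
  have hinj : Function.Injective ![p, x, y, q] := by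
    have := hxp.ne
    have := hyq.ne
    have := hxy.ne
    have := hpy.1
    have := hqx.1
    intro i j hij
    fin_cases i <;> fin_cases j <;> simp_all [eq_comm]
  by_cases hadj : H.Adj p q
  · refine h.1.false ⟨⟨![p, x, y, q], hinj⟩, ?_⟩
    intro i j
    fin_cases i <;> fin_cases j <;>
      simp [cycleGraph_adj, hxp, hxp.symm, hyq, hyq.symm, hxy, hxy.symm, hyp, hpy', hxq, hqx',
        hadj, hadj.symm] <;> decide
  · have hadj' : ¬ H.Adj q p := fun h => hadj h.symm
    refine h.2.false ⟨⟨![p, x, y, q], hinj⟩, ?_⟩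
    intro i j
    fin_cases i <;> fin_cases j <;>
      simp [pathGraph_adj, hxp, hxp.symm, hyq, hyq.symm, hxy, hxy.symm, hyp, hpy', hxq, hqx',
        hadj, hadj']

theorem NestedNbhds.triviallyPerfect (h : NestedNbhds H) : TriviallyPerfect H := by
  have key : ∀ a b c d : V, H.Adj a b → H.Adj b c → H.Adj c d → ¬ H.Adj a c → ¬ H.Adj b d →
      a ≠ c → b ≠ d → False := by
    intro a b c d hab hbc hcd hac hbd hne hne'
    rcases h b c hbc with hs | hs
    · rcases hs (Or.inr hab.symm) with h' | h'
      · exact hne h'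
      · exact hac h'.symm
    · rcases hs (Or.inr hcd) with h' | h'
      · exact hne' h'.symm
      · exact hbd h'
  constructor <;> constructor <;> intro f
  · refine key (f 0) (f 1) (f 2) (f 3) ?_ ?_ ?_ ?_ ?_ ?_ ?_ <;>
      simp [cycleGraph_adj] <;> decide
  · refine key (f 0) (f 1) (f 2) (f 3) ?_ ?_ ?_ ?_ ?_ ?_ ?_ <;>
      simp [pathGraph_adj]

end Nested

section Minimality

variable {V : Type u} {G : SimpleGraph V} {S : Set (Sym2 V)}

theorem completes_adj {x y : V} :
    (completes G S).Adj x y ↔ G.Adj x y ∨ (s(x, y) ∈ S ∧ x ≠ y) := by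
  simp [completes]

/-- In a minimal completion, every vertex `u` has an original neighbour in each nonempty union
`T` of branches hanging below it. -/
theorem IsMinTPCompletion.exists_adj (hS : IsMinTPCompletion G S) {u : V} {T : Set V}
    (hT : T.Nonempty) (huT : u ∉ T)
    (hsub : ∀ z ∈ T, closedNbhd (completes G S) z ⊆ closedNbhd (completes G S) u)
    (hout : ∀ z ∈ T, ∀ w ∉ T, (completes G S).Adj z w →
      closedNbhd (completes G S) u ⊆ closedNbhd (completes G S) w) :
    ∃ z ∈ T, G.Adj u z := by
  by_contra! hno
  set H := completes G S with hH
  have hnest : NestedNbhds H := hS.2.1.nestedNbhds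
  have hadj : ∀ z ∈ T, H.Adj u z := fun z hz => by
    rcases hsub z hz (self_mem_closedNbhd z) with h | h
    · exact absurd (h ▸ hz) huT
    · exact h
  set S' : Set (Sym2 V) := S \ {e | ∃ z ∈ T, e = s(u, z)} with hS'
  have hlt : S' ⊂ S := by
    refine ⟨Set.sdiff_subset, fun hle => ?_⟩
    obtain ⟨z, hz⟩ := hT
    rcases completes_adj.1 (hadj z hz) with h | h
    · exact hno z hz h
    · exact (hle h.1).2 ⟨z, hz, rfl⟩
  refine hS.2.2 S' hlt (NestedNbhds.triviallyPerfect ?_)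
  have hadj' : ∀ x y, (completes G S').Adj x y ↔
      H.Adj x y ∧ ¬ (x = u ∧ y ∈ T) ∧ ¬ (y = u ∧ x ∈ T) := by
    intro x y
    have hG1 : x = u → y ∈ T → ¬ G.Adj x y := fun h h' => h ▸ hno y h'
    have hG2 : y = u → x ∈ T → ¬ G.Adj x y := fun h h' h'' => hno x h' (h ▸ h''.symm)
    have hmem : (∃ z ∈ T, s(x, y) = s(u, z)) ↔ (x = u ∧ y ∈ T) ∨ (y = u ∧ x ∈ T) := by
      constructor
      · rintro ⟨z, hz, he⟩
        rcases Sym2.eq_iff.1 he with ⟨rfl, rfl⟩ | ⟨rfl, rfl⟩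
        · exact Or.inl ⟨rfl, hz⟩
        · exact Or.inr ⟨rfl, hz⟩
      · rintro (⟨rfl, h⟩ | ⟨rfl, h⟩)
        · exact ⟨y, h, rfl⟩
        · exact ⟨x, h, Sym2.eq_swap⟩
    rw [hH, completes_adj, completes_adj, hS', Set.mem_sdiff, Set.mem_ofPred_eq, hmem]
    tauto
  have hmem : ∀ x y, y ∈ closedNbhd (completes G S') x ↔
      y ∈ closedNbhd H x ∧ ¬ (x = u ∧ y ∈ T) ∧ ¬ (y = u ∧ x ∈ T) := by
    intro x y
    simp only [closedNbhd, Set.mem_ofPred_eq, hadj']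
    constructor
    · rintro (rfl | h)
      · exact ⟨Or.inl rfl, fun h => huT (h.1 ▸ h.2), fun h => huT (h.1 ▸ h.2)⟩
      · exact ⟨Or.inr h.1, h.2⟩
    · rintro ⟨rfl | h, h'⟩
      · exact Or.inl rfl
      · exact Or.inr ⟨h, h'⟩
  have hu : ∀ y ∉ T, H.Adj u y →
      closedNbhd (completes G S') u ⊆ closedNbhd (completes G S') y ∨
        closedNbhd (completes G S') y ⊆ closedNbhd (completes G S') u := by
    intro y hy huy
    by_cases hle : closedNbhd H u ⊆ closedNbhd H y
    · left
      intro z hz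
      rw [hmem] at hz ⊢
      exact ⟨hle hz.1, fun h => huy.ne h.1.symm, fun h => hy h.2⟩
    · right
      have hle' := (hnest u y huy).resolve_left hle
      intro z hz
      rw [hmem] at hz ⊢
      refine ⟨hle' hz.1, fun h => hle ?_, fun h => huT h.2⟩
      rcases hz.1 with h' | h'
      · exact absurd (h' ▸ h.2) hy
      · exact hout z h.2 y hy h'.symm
  have hTout : ∀ x ∈ T, ∀ y ∉ T, y ≠ u → H.Adj x y →
      closedNbhd (completes G S') x ⊆ closedNbhd (completes G S') y := by
    intro x hx y hy hyu hxy z hz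
    rw [hmem] at hz ⊢
    exact ⟨hout x hx y hy hxy (hsub x hx hz.1), fun h => hyu h.1, fun h => hy h.2⟩
  intro x y hxy
  rw [hadj'] at hxy
  obtain ⟨hxy, h1, h2⟩ := hxy
  by_cases hxu : x = u
  · subst hxu
    exact hu y (fun h => h1 ⟨rfl, h⟩) hxy
  by_cases hyu : y = u
  · subst hyu
    exact (hu x (fun h => h2 ⟨rfl, h⟩) hxy.symm).symm
  by_cases hxT : x ∈ T <;> by_cases hyT : y ∈ T
  · refine (hnest x y hxy).imp (fun hle z hz => ?_) (fun hle z hz => ?_) <;>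
      rw [hmem] at hz ⊢
    · exact ⟨hle hz.1, fun h => hyu h.1, fun h => hz.2.2 ⟨h.1, hxT⟩⟩
    · exact ⟨hle hz.1, fun h => hxu h.1, fun h => hz.2.2 ⟨h.1, hyT⟩⟩
  · exact Or.inl (hTout x hxT y hyT hyu hxy)
  · exact Or.inr (hTout y hyT x hxT hxu hxy.symm)
  · refine (hnest x y hxy).imp (fun hle z hz => ?_) (fun hle z hz => ?_) <;>
      rw [hmem] at hz ⊢
    · exact ⟨hle hz.1, fun h => hyu h.1, fun h => hyT h.2⟩
    · exact ⟨hle hz.1, fun h => hxu h.1, fun h => hxT h.2⟩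

end Minimality

section Trace

variable {V : Type u} {H : SimpleGraph V} {Ω : Set V}

theorem subset_closedNbhd_of_mem (hΩ : Maximal H.IsClique Ω) {x : V} (hx : x ∈ Ω) :
    Ω ⊆ closedNbhd H x := by
  intro y hy
  by_cases h : y = x
  · exact Or.inl h
  · exact Or.inr (hΩ.prop hx hy (Ne.symm h))

theorem mem_of_subset_closedNbhd (hΩ : Maximal H.IsClique Ω) {x : V}
    (hx : Ω ⊆ closedNbhd H x) : x ∈ Ω := by
  have hcl : H.IsClique (insert x Ω) := by
    refine hΩ.prop.insert fun y hy hne => ?_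
    rcases hx hy with h | h
    · exact absurd h.symm hne
    · exact h
  exact hΩ.le_of_ge hcl (Set.subset_insert x Ω) (Set.mem_insert x Ω)

/-- The traces of closed neighbourhoods on a maximal clique form a chain. -/
theorem NestedNbhds.trace_total (hH : NestedNbhds H) (hΩ : Maximal H.IsClique Ω) (x y : V) :
    closedNbhd H x ∩ Ω ⊆ closedNbhd H y ∩ Ω ∨ closedNbhd H y ∩ Ω ⊆ closedNbhd H x ∩ Ω := by
  by_contra! hcon
  obtain ⟨h1, h2⟩ := hcon
  obtain ⟨u, ⟨hux, huΩ⟩, huy⟩ := Set.not_subset.1 h1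
  obtain ⟨w, ⟨hwy, hwΩ⟩, hwx⟩ := Set.not_subset.1 h2
  have huw : u ≠ w := by
    rintro rfl
    exact hwx ⟨hux, huΩ⟩
  rcases hH u w (hΩ.prop huΩ hwΩ huw) with h | h
  · exact hwx ⟨mem_closedNbhd_comm.1 (h (mem_closedNbhd_comm.1 hux)), hwΩ⟩
  · exact huy ⟨mem_closedNbhd_comm.1 (h (mem_closedNbhd_comm.1 hwy)), huΩ⟩

/-- Outside a maximal clique, the trace is constant along edges. -/
theorem NestedNbhds.trace_eq (hH : NestedNbhds H) (hΩ : Maximal H.IsClique Ω) {x y : V}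
    (hx : x ∉ Ω) (hy : y ∉ Ω) (hxy : H.Adj x y) :
    closedNbhd H x ∩ Ω = closedNbhd H y ∩ Ω := by
  have key : ∀ x y : V, x ∉ Ω → H.Adj x y →
      closedNbhd H x ∩ Ω ⊆ closedNbhd H y ∩ Ω := by
    rintro x y hx hxy u ⟨hux, huΩ⟩
    have hadj : H.Adj x u := hux.resolve_left fun h => hx (h ▸ huΩ)
    rcases hH x u hadj with h | h
    · exact ⟨mem_closedNbhd_comm.1 (h (Or.inr hxy)), huΩ⟩
    · exact absurd (mem_of_subset_closedNbhd hΩ ((subset_closedNbhd_of_mem hΩ huΩ).trans h)) hx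
  exact (key x y hx hxy).antisymm (key y x hy hxy.symm)

/-- A nonempty set of vertices contains one whose trace on a maximal clique is the largest. -/
theorem NestedNbhds.exists_max_trace [Finite V] (hH : NestedNbhds H)
    (hΩ : Maximal H.IsClique Ω) {P : Set V} (hP : P.Nonempty) :
    ∃ x ∈ P, ∀ y ∈ P, closedNbhd H y ∩ Ω ⊆ closedNbhd H x ∩ Ω := by
  obtain ⟨x, hx, hmax⟩ :=
    Set.exists_max_image P (fun x => (closedNbhd H x ∩ Ω).ncard) P.toFinite hP
  refine ⟨x, hx, fun y hy => ?_⟩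
  rcases hH.trace_total hΩ y x with h | h
  · exact h
  · exact (Set.eq_of_subset_of_ncard_le h (hmax y hy) (Set.toFinite _)).ge

end Trace

/-- Description of a maximal clique of a minimal completion, up to a set `E`, by two closed
neighbourhoods of vertices outside `E` and the neighbourhood of a subset of `E`. -/
theorem IsMinTPCompletion.exists_description {V : Type u} [Finite V] {G : SimpleGraph V}
    {S : Set (Sym2 V)} (hS : IsMinTPCompletion G S) {Ω : Set V}
    (hΩ : Maximal (completes G S).IsClique Ω) (E : Set V) :
    ∃ X Y F : Set V, (X = ∅ ∨ ∃ v ∉ E, X = closedNbhd (completes G S) v) ∧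
      (Y = ∅ ∨ ∃ v ∉ E, Y = closedNbhd (completes G S) v) ∧ F ⊆ E ∧
      Ω \ E = (X ∩ Y ∪ {z | ∃ e ∈ F, G.Adj e z}) \ E := by
  set H := completes G S with hHdef
  have hH : NestedNbhds H := hS.2.1.nestedNbhds
  have hGH : ∀ x y, G.Adj x y → H.Adj x y := fun x y h => completes_adj.2 (Or.inl h)
  by_cases ha : Ω \ E = ∅
  · refine ⟨∅, ∅, ∅, Or.inl rfl, Or.inl rfl, Set.empty_subset _, ?_⟩
    simp [ha]
  by_cases hb : ∃ y ∈ Ω \ E, ∀ x, x ∉ Ω → x ∉ E → ¬ H.Adj x y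
  · obtain ⟨y, ⟨hyΩ, hyE⟩, hy⟩ := hb
    refine ⟨closedNbhd H y, closedNbhd H y, ∅, Or.inr ⟨y, hyE, rfl⟩, Or.inr ⟨y, hyE, rfl⟩,
      Set.empty_subset _, ?_⟩
    ext z
    simp only [Set.mem_sdiff, Set.inter_self, Set.mem_union, Set.mem_ofPred_eq,
      Set.mem_empty_iff_false, false_and, exists_false, or_false]
    refine and_congr_left fun hzE => ⟨fun h => subset_closedNbhd_of_mem hΩ hyΩ h, fun h => ?_⟩
    by_contra hzΩ
    rcases h with rfl | h
    · exact hzΩ hyΩ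
    · exact hy z hzΩ hzE h.symm
  push Not at hb
  obtain ⟨y₀, hy₀⟩ := Set.nonempty_iff_ne_empty.2 ha
  obtain ⟨x₀, hx₀Ω, hx₀E, -⟩ := hb y₀ hy₀
  obtain ⟨x₁, ⟨hx₁Ω, hx₁E⟩, hmax₁⟩ := hH.exists_max_trace hΩ (P := {x | x ∉ Ω ∧ x ∉ E})
    ⟨x₀, hx₀Ω, hx₀E⟩
  set A₁ := closedNbhd H x₁ ∩ Ω with hA₁
  have hcheap : Ω \ E ⊆ A₁ := by
    intro y hy
    obtain ⟨x, hxΩ, hxE, hxy⟩ := hb y hy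
    exact hmax₁ x ⟨hxΩ, hxE⟩ ⟨Or.inr hxy, hy.1⟩
  have htr : ∀ x ∈ Ω, closedNbhd H x ∩ Ω = Ω := fun x hx =>
    Set.inter_eq_right.2 (subset_closedNbhd_of_mem hΩ hx)
  obtain ⟨w₁, hw₁Ω, hw₁⟩ : ∃ w ∈ Ω, w ∉ A₁ := by
    by_contra! hall
    exact hx₁Ω (mem_of_subset_closedNbhd hΩ fun w hw => (hall w hw).1)
  obtain ⟨Y, hY, hYΩ, hYmax⟩ : ∃ Y : Set V, (Y = ∅ ∨ ∃ v ∉ E, Y = closedNbhd H v) ∧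
      closedNbhd H x₁ ∩ Y ⊆ Ω ∧ ∀ x, x ∉ Ω → x ∉ E →
        closedNbhd H x ∩ Ω = A₁ ∨ closedNbhd H x ∩ Ω ⊆ closedNbhd H x₁ ∩ Y := by
    by_cases hne : {x | x ∉ Ω ∧ x ∉ E ∧ closedNbhd H x ∩ Ω ≠ A₁}.Nonempty
    · obtain ⟨x₂, ⟨hx₂Ω, hx₂E, hx₂⟩, hmax₂⟩ := hH.exists_max_trace hΩ hne
      refine ⟨closedNbhd H x₂, Or.inr ⟨x₂, hx₂E, rfl⟩, ?_, ?_⟩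
      · rintro z ⟨hz₁, hz₂⟩
        by_contra hzΩ
        have key : ∀ x, x ∉ Ω → z ∈ closedNbhd H x →
            closedNbhd H x ∩ Ω = closedNbhd H z ∩ Ω := by
          rintro x hx (rfl | h)
          · rfl
          · exact hH.trace_eq hΩ hx hzΩ h
        exact hx₂ ((key x₂ hx₂Ω hz₂).trans (key x₁ hx₁Ω hz₁).symm)
      · intro x hxΩ hxE
        by_cases hx : closedNbhd H x ∩ Ω = A₁
        · exact Or.inl hx
        · exact Or.inr fun w hw => ⟨(hmax₁ x ⟨hxΩ, hxE⟩ hw).1, (hmax₂ x ⟨hxΩ, hxE, hx⟩ hw).1⟩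
    · refine ⟨∅, Or.inl rfl, by simp, fun x hxΩ hxE => Or.inl ?_⟩
      by_contra hx
      exact hne ⟨x, hxΩ, hxE, hx⟩
  set A₂ := closedNbhd H x₁ ∩ Y with hA₂
  refine ⟨closedNbhd H x₁, Y,
    {e ∈ E | ¬ closedNbhd H e ∩ Ω ⊆ A₂ ∧ e ∉ A₁ ∧ closedNbhd H e ∩ Ω ≠ A₁},
    Or.inr ⟨x₁, hx₁E, rfl⟩, hY, fun e he => he.1, ?_⟩
  -- a vertex outside `Ω` that is adjacent to `u ∈ Ω` lies below `u`
  have hbelow : ∀ u ∈ Ω, ∀ z, z ∉ Ω → u ∈ closedNbhd H z → closedNbhd H z ⊆ closedNbhd H u := by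
    intro u hu z hz huz
    have hadj : H.Adj z u := huz.resolve_left fun h => hz (h ▸ hu)
    refine (hH z u hadj).resolve_right fun h => hz ?_
    exact mem_of_subset_closedNbhd hΩ ((subset_closedNbhd_of_mem hΩ hu).trans h)
  refine Set.Subset.antisymm ?_ ?_
  · rintro u ⟨huΩ, huE⟩
    refine ⟨?_, huE⟩
    by_cases huA₂ : u ∈ A₂
    · exact Or.inl huA₂
    right
    have huA₁ : u ∈ A₁ := hcheap ⟨huΩ, huE⟩
    have hQ : ∀ w ∈ Ω, closedNbhd H u ⊆ closedNbhd H w → w ∈ A₁ := fun w hw hle =>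
      ⟨mem_closedNbhd_comm.1 (hle (mem_closedNbhd_comm.1 huA₁.1)), hw⟩
    by_cases hcase : ∀ w ∈ A₁, closedNbhd H u ⊆ closedNbhd H w
    · obtain ⟨z, ⟨hz1, hz2⟩, hadj⟩ := hS.exists_adj (u := u)
        (T := {z | A₁ ⊂ closedNbhd H z ∩ Ω ∧ z ∉ A₁})
        ⟨w₁, (htr w₁ hw₁Ω).symm ▸ ⟨Set.inter_subset_right, fun h => hw₁ (h hw₁Ω)⟩, hw₁⟩
        (fun h => h.2 huA₁)
        (by
          rintro z ⟨hz1, hz2⟩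
          have huz := (hz1.1 huA₁).1
          by_cases hzΩ : z ∈ Ω
          · have hne : z ≠ u := fun h => hz2 (h ▸ huA₁)
            exact (hH z u (hΩ.prop hzΩ huΩ hne)).resolve_right fun h => hz2 (hQ z hzΩ h)
          · exact hbelow u huΩ z hzΩ huz)
        (by
          rintro z ⟨hz1, hz2⟩ w hw hzw
          by_cases hwA : w ∈ A₁
          · exact hcase w hwA
          exfalso
          refine hw ⟨?_, hwA⟩
          by_cases hwΩ : w ∈ Ω
          · rw [htr w hwΩ]
            exact ⟨Set.inter_subset_right, fun h => hw₁ (h hw₁Ω)⟩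
          by_cases hzΩ : z ∈ Ω
          · have hzw' : z ∈ closedNbhd H w ∩ Ω := ⟨Or.inr hzw.symm, hzΩ⟩
            rcases hH.trace_total hΩ w x₁ with h | h
            · exact absurd (h hzw') hz2
            · exact ⟨h, fun h' => hz2 (h' hzw')⟩
          · rwa [← hH.trace_eq hΩ hzΩ hwΩ hzw])
      refine ⟨z, ⟨?_, ?_, hz2, hz1.ne'⟩, hadj.symm⟩
      · by_contra hzE
        by_cases hzΩ : z ∈ Ω
        · exact hz2 (hcheap ⟨hzΩ, hzE⟩)
        · exact hz1.2 (hmax₁ z ⟨hzΩ, hzE⟩)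
      · exact fun h => huA₂ (h (hz1.1 huA₁))
    · push Not at hcase
      set Q : Set V := {w ∈ Ω | closedNbhd H u ⊆ closedNbhd H w} with hQdef
      obtain ⟨w₀, hw₀A, hw₀⟩ := hcase
      obtain ⟨w, ⟨hwA, hw⟩, hwmax⟩ := Set.exists_max_image
        {w | w ∈ A₁ ∧ ¬ closedNbhd H u ⊆ closedNbhd H w} (fun w => (closedNbhd H w).ncard)
        (Set.toFinite _) ⟨w₀, hw₀A, hw₀⟩
      have hQne : Q ≠ A₁ := fun h => hw (h.symm ▸ hwA : w ∈ Q).2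
      obtain ⟨z, hzu, hzw⟩ := Set.not_subset.1 hw
      have hzΩ : z ∉ Ω := fun h => hzw (subset_closedNbhd_of_mem hΩ hwA.2 h)
      have hzQ : closedNbhd H z ∩ Ω = Q := by
        refine Set.Subset.antisymm ?_ ?_
        · rintro v ⟨hvz, hvΩ⟩
          refine ⟨hvΩ, ?_⟩
          by_contra hv
          have hvA : v ∈ A₁ := by
            rcases hH.trace_total hΩ z x₁ with h | h
            · exact h ⟨hvz, hvΩ⟩
            · exact absurd (mem_closedNbhd_comm.1 (h hwA).1) hzw
          have hvw : v ≠ w := by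
            rintro rfl
            exact hzw (mem_closedNbhd_comm.1 hvz)
          have hle : closedNbhd H v ⊆ closedNbhd H w := by
            rcases hH v w (hΩ.prop hvΩ hwA.2 hvw) with h | h
            · exact h
            · exact (Set.eq_of_subset_of_ncard_le h (hwmax v ⟨hvA, hv⟩) (Set.toFinite _)).ge
          exact hzw (hle (mem_closedNbhd_comm.1 hvz))
        · rintro v ⟨hvΩ, hv⟩
          exact ⟨mem_closedNbhd_comm.1 (hv hzu), hvΩ⟩
      have huQ : u ∈ Q := ⟨huΩ, subset_rfl⟩
      obtain ⟨t, ⟨htΩ, htQ⟩, hadj⟩ := hS.exists_adj (u := u)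
        (T := {t | t ∉ Ω ∧ closedNbhd H t ∩ Ω = Q}) ⟨z, hzΩ, hzQ⟩ (fun h => h.1 huΩ)
        (fun t ht => hbelow u huΩ t ht.1 (ht.2.symm ▸ huQ : u ∈ closedNbhd H t ∩ Ω).1)
        (by
          rintro t ⟨htΩ, htQ⟩ v hv htv
          by_cases hvΩ : v ∈ Ω
          · exact (htQ ▸ ⟨Or.inr htv, hvΩ⟩ : v ∈ Q).2
          · exact absurd ⟨hvΩ, (hH.trace_eq hΩ htΩ hvΩ htv).symm.trans htQ⟩ hv)
      refine ⟨t, ⟨?_, ?_, fun h => htΩ h.2, htQ ▸ hQne⟩, hadj.symm⟩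
      · by_contra htE
        rcases hYmax t htΩ htE with h | h
        · exact hQne (htQ.symm.trans h)
        · exact huA₂ (h (htQ.symm ▸ huQ))
      · exact fun h => huA₂ (h (htQ.symm ▸ huQ))
  · rintro z ⟨hz | ⟨e, ⟨heE, he₂, he₁, heA⟩, hadj⟩, hzE⟩
    · exact ⟨hYΩ hz, hzE⟩
    · refine ⟨?_, hzE⟩
      by_contra hzΩ
      have hez := hGH _ _ hadj
      by_cases heΩ : e ∈ Ω
      · exact he₁ (hmax₁ z ⟨hzΩ, hzE⟩ ⟨Or.inr hez.symm, heΩ⟩)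
      · rw [hH.trace_eq hΩ heΩ hzΩ hez] at he₂ heA
        exact (hYmax z hzΩ hzE).elim heA he₂

section Counting

variable {V : Type u}

/-- The set of vertices listed by a tuple of optional vertices. -/
def tupleSet {m : ℕ} (f : Fin m → Option V) : Set V := {v | ∃ i, f i = some v}

theorem exists_tupleSet [Finite V] {m : ℕ} {A : Set V} (hA : A.ncard ≤ m) :
    ∃ f : Fin m → Option V, tupleSet f = A := by
  classical
  have : Fintype A := Fintype.ofFinite A
  have hcard : Fintype.card A ≤ m := by
    rwa [← Nat.card_eq_fintype_card, Nat.card_coe_set_eq]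
  let e := Fintype.equivFin A
  refine ⟨fun i => if h : (i : ℕ) < Fintype.card A then some (e.symm ⟨i, h⟩ : V) else none, ?_⟩
  ext v
  simp only [tupleSet, Set.mem_ofPred_eq]
  constructor
  · rintro ⟨i, hi⟩
    split_ifs at hi with h
    rw [← Option.some.inj hi]
    exact (e.symm ⟨i, h⟩).2
  · intro hv
    refine ⟨⟨e ⟨v, hv⟩, (e ⟨v, hv⟩).2.trans_le hcard⟩, ?_⟩
    rw [dif_pos (e ⟨v, hv⟩).2, Fin.eta, e.symm_apply_apply]

/-- The set coded by an optional vertex and a tuple: its closed neighbourhood enlarged by the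
tuple, or the empty set. -/
def codedNbhd (G : SimpleGraph V) {m : ℕ} (v : Option V) (f : Fin m → Option V) : Set V :=
  match v with
  | none => ∅
  | some v => closedNbhd G v ∪ tupleSet f

/-- The data describing a vital potential maximal clique. -/
abbrev CliqueCode (V : Type u) (m : ℕ) : Type u :=
  (Fin 2 → Option V) × (Fin 5 → Fin m → Option V)

/-- The vertex set described by a code. -/
def CliqueCode.decode (G : SimpleGraph V) {m : ℕ} (p : CliqueCode V m) : Set V :=
  (codedNbhd G (p.1 0) (p.2 0) ∩ codedNbhd G (p.1 1) (p.2 1) ∪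
    {z | ∃ e ∈ tupleSet (p.2 2), G.Adj e z}) \ tupleSet (p.2 3) ∪ tupleSet (p.2 4)

theorem exists_codedNbhd [Finite V] {G : SimpleGraph V} {S : Set (Sym2 V)} {m : ℕ} {E X : Set V}
    (hE : ∀ v ∉ E, {w | s(v, w) ∈ S}.ncard ≤ m)
    (hdiag : ∀ e ∈ S, ¬ e.IsDiag)
    (hX : X = ∅ ∨ ∃ v ∉ E, X = closedNbhd (completes G S) v) :
    ∃ (v : Option V) (f : Fin m → Option V), codedNbhd G v f = X := by
  rcases hX with rfl | ⟨v, hv, rfl⟩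
  · exact ⟨none, fun _ => none, rfl⟩
  · obtain ⟨f, hf⟩ := exists_tupleSet (hE v hv)
    refine ⟨some v, f, ?_⟩
    ext w
    have : s(v, w) ∈ S → v ≠ w := fun h h' => hdiag _ h h'
    simp only [codedNbhd, hf, closedNbhd, Set.mem_union, Set.mem_ofPred_eq, completes_adj]
    tauto

/-- Few vertices are incident to many pairs of `S`. -/
theorem ncard_heavy_le [Fintype V] {S : Set (Sym2 V)} (hdiag : ∀ e ∈ S, ¬ e.IsDiag) {k : ℕ}
    (hS : S.ncard ≤ k) :
    {v | Nat.sqrt k < {w | s(v, w) ∈ S}.ncard}.ncard ≤ 2 * Nat.sqrt k + 1 := by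
  classical
  obtain ⟨F, hF⟩ : ∃ F, F = SimpleGraph.fromEdgeSet S := ⟨_, rfl⟩
  have hdeg : ∀ v, {w | s(v, w) ∈ S}.ncard = F.degree v := by
    intro v
    rw [← F.card_neighborSet_eq_degree, ← Nat.card_eq_fintype_card, Nat.card_coe_set_eq]
    congr 1
    ext w
    have : s(v, w) ∈ S → v ≠ w := fun h h' => hdiag _ h h'
    simp only [hF, Set.mem_ofPred_eq, mem_neighborSet, fromEdgeSet_adj]
    tauto
  have hedge : F.edgeFinset.card ≤ k := by
    refine le_trans ?_ hS
    rw [← Set.ncard_coe_finset, coe_edgeFinset, hF, edgeSet_fromEdgeSet]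
    exact Set.ncard_le_ncard Set.sdiff_subset
  have hsum := F.sum_degrees_eq_twice_card_edges
  set A : Finset V := Finset.univ.filter fun v => Nat.sqrt k < F.degree v with hA
  have hAset : {v | Nat.sqrt k < {w | s(v, w) ∈ S}.ncard} = (A : Set V) := by
    ext v
    simp [hA, hdeg]
  rw [hAset, Set.ncard_coe_finset]
  have h1 : A.card * (Nat.sqrt k + 1) ≤ ∑ v ∈ A, F.degree v := by
    rw [← smul_eq_mul]
    refine Finset.card_nsmul_le_sum _ _ _ fun v hv => ?_
    exact (Finset.mem_filter.1 hv).2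
  have h2 : ∑ v ∈ A, F.degree v ≤ ∑ v, F.degree v :=
    Finset.sum_le_sum_of_subset (Finset.subset_univ A)
  have h3 := Nat.lt_succ_sqrt k
  by_contra! hlt
  have h4 : (2 * Nat.sqrt k + 2) * (Nat.sqrt k + 1) ≤ A.card * (Nat.sqrt k + 1) :=
    Nat.mul_le_mul_right _ hlt
  have h5 : A.card * (Nat.sqrt k + 1) ≤ 2 * k :=
    h1.trans (h2.trans (hsum.trans_le (Nat.mul_le_mul_left 2 hedge)))
  simp only [Nat.succ_eq_add_one] at h3
  nlinarith

theorem VitalPMC.exists_code [Fintype V] {G : SimpleGraph V} {k : ℕ} {Ω : Set V}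
    (h : VitalPMC G k Ω) :
    ∃ p : CliqueCode V (2 * Nat.sqrt k + 1), p.decode G = Ω := by
  obtain ⟨S, hS, hk, hΩ⟩ := h
  set m := 2 * Nat.sqrt k + 1
  set E : Set V := {v | Nat.sqrt k < {w | s(v, w) ∈ S}.ncard}
  have hEcard : E.ncard ≤ m := ncard_heavy_le hS.1.1 hk
  have hlight : ∀ v ∉ E, {w | s(v, w) ∈ S}.ncard ≤ m := fun v hv =>
    (not_lt.1 hv).trans (by omega)
  obtain ⟨X, Y, F, hX, hY, hFE, heq⟩ := hS.exists_description hΩ E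
  obtain ⟨v₀, f₀, h₀⟩ := exists_codedNbhd hlight hS.1.1 hX
  obtain ⟨v₁, f₁, h₁⟩ := exists_codedNbhd hlight hS.1.1 hY
  obtain ⟨f₂, h₂⟩ := exists_tupleSet ((Set.ncard_le_ncard hFE).trans hEcard)
  obtain ⟨f₃, h₃⟩ := exists_tupleSet hEcard
  obtain ⟨f₄, h₄⟩ := exists_tupleSet
    ((Set.ncard_le_ncard (Set.inter_subset_right : Ω ∩ E ⊆ E)).trans hEcard)
  refine ⟨⟨![v₀, v₁], ![f₀, f₁, f₂, f₃, f₄]⟩, ?_⟩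
  change (codedNbhd G v₀ f₀ ∩ codedNbhd G v₁ f₁ ∪ {z | ∃ e ∈ tupleSet f₂, G.Adj e z}) \
    tupleSet f₃ ∪ tupleSet f₄ = Ω
  rw [h₀, h₁, h₂, h₃, h₄, ← heq, Set.sdiff_union_inter]

theorem card_cliqueCode [Fintype V] (m : ℕ) :
    Nat.card (CliqueCode V m) = (Fintype.card V + 1) ^ (5 * m + 2) := by
  rw [CliqueCode, Nat.card_prod, Nat.card_fun, Nat.card_fun, Nat.card_fun]
  simp only [Nat.card_eq_fintype_card, Fintype.card_fin, Fintype.card_option]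
  rw [← pow_mul, ← pow_add]
  ring_nf

end Counting

theorem succ_pow_le_two_rpow {a : ℝ} (ha : 0 < a) {n k : ℕ} (hk : 2 ≤ k)
    (hn : (n : ℝ) ≤ a * (k : ℝ) ^ 3) :
    ((n : ℝ) + 1) ^ (5 * (2 * Nat.sqrt k + 1) + 2) ≤
      (2 : ℝ) ^ ((17 * (Real.log (a + 1) / Real.log 2 ^ 2 + 3 / Real.log 2)) *
        Real.sqrt k * Real.log k) := by
  have hk' : (2 : ℝ) ≤ k := by exact_mod_cast hk
  have hl2 : 0 < Real.log 2 := Real.log_pos (by norm_num)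
  have hlk : Real.log 2 ≤ Real.log k := Real.log_le_log (by norm_num) hk'
  have hla : 0 < Real.log (a + 1) := Real.log_pos (by linarith)
  have hk3 : (1 : ℝ) ≤ (k : ℝ) ^ 3 := one_le_pow₀ (by linarith)
  have hn1 : (n : ℝ) + 1 ≤ (a + 1) * (k : ℝ) ^ 3 := by linarith
  have hn0 : (0 : ℝ) < (n : ℝ) + 1 := by positivity
  have hs1 : 1 ≤ Real.sqrt k := Real.one_le_sqrt.2 (by linarith)
  have hs : (Nat.sqrt k : ℝ) ≤ Real.sqrt k := Real.nat_sqrt_le_real_sqrt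
  have hlogn : Real.log ((n : ℝ) + 1) ≤ Real.log (a + 1) + 3 * Real.log k := by
    refine (Real.log_le_log hn0 hn1).trans_eq ?_
    rw [Real.log_mul (by positivity) (by positivity), Real.log_pow]
    norm_num
  have hratio : 1 ≤ Real.log k / Real.log 2 := (one_le_div hl2).2 hlk
  have hexp : Real.log (a + 1) + 3 * Real.log k ≤
      (Real.log (a + 1) * (Real.log k / Real.log 2) + 3 * Real.log k) := by
    nlinarith
  have h0 : 0 ≤ Real.log (a + 1) * (Real.log k / Real.log 2) + 3 * Real.log k := by positivity
  rw [← Real.log_le_log_iff (by positivity) (by positivity), Real.log_pow,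
    Real.log_rpow (by norm_num)]
  push_cast
  calc (5 * (2 * (Nat.sqrt k : ℝ) + 1) + 2) * Real.log ((n : ℝ) + 1)
      ≤ (17 * Real.sqrt k) *
          (Real.log (a + 1) * (Real.log k / Real.log 2) + 3 * Real.log k) := by
        refine mul_le_mul (by linarith) (hlogn.trans hexp) (Real.log_nonneg (by simp))
          (by positivity)
    _ = _ := by
        field_simp

/-- Enumeration lemma: for a graph on at most `a·k³` vertices, there is a family of at most
`2^{c·√k·log k}` vertex subsets containing all vital potential maximal cliques of `(G, k)`. -/
theorem enumeration_of_vitalPMCs :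
    ∀ a : ℝ, 0 < a → ∃ c : ℝ, 0 < c ∧
      ∀ (V : Type u) (_ : Fintype V) (G : SimpleGraph V) (k : ℕ), 2 ≤ k →
        (Fintype.card V : ℝ) ≤ a * (k : ℝ) ^ 3 →
        ∃ 𝒞 : Set (Set V),
          (𝒞.ncard : ℝ) ≤ (2 : ℝ) ^ (c * Real.sqrt k * Real.log k) ∧
          ∀ Ω : Set V, VitalPMC G k Ω → Ω ∈ 𝒞 := by
  intro a ha
  have hl2 : 0 < Real.log 2 := Real.log_pos (by norm_num)
  have hla : 0 < Real.log (a + 1) := Real.log_pos (by linarith)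
  refine ⟨17 * (Real.log (a + 1) / Real.log 2 ^ 2 + 3 / Real.log 2), by positivity, ?_⟩
  intro V _ G k hk hn
  refine ⟨Set.range (CliqueCode.decode G (m := 2 * Nat.sqrt k + 1)), ?_,
    fun Ω hΩ => hΩ.exists_code⟩
  refine le_trans ?_ (succ_pow_le_two_rpow ha hk hn)
  have hcard : (Set.range (CliqueCode.decode G (m := 2 * Nat.sqrt k + 1))).ncard ≤
      (Fintype.card V + 1) ^ (5 * (2 * Nat.sqrt k + 1) + 2) := by
    rw [← card_cliqueCode, ← Set.image_univ, ← Set.ncard_univ]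
    exact Set.ncard_image_le Set.finite_univ
  exact_mod_cast hcard
end

section
/- Let φ be a 3-CNF formula in which every clause has exactly three literals whose variables are pairwise distinct, and let G_φ and k_φ = |V(φ)| + 2|C(φ)| be as defined in the context. Then φ is satisfiable if and only if there exists a set S ⊆ E(G_φ) with |S| ≤ k_φ such that G_φ − S contains no induced cycle on four vertices (no induced C4). -/
open SimpleGraph

/-- The graph `G_φ` of the reduction from 3-SAT to `C₄`-free edge deletion.
For each variable `x` the gadget has six vertices (indices `0,1,2` are `w^x_0, w^x_1, w^x_2`,
`3` is `n^x`, `4` is `p^x`, `5` is `t^x`); for each clause `c` the gadget has six vertices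
(indices `0,1,2` are `a^c_0, a^c_1, a^c_2` and `3,4,5` are `b^c_0, b^c_1, b^c_2`).
`lit c a` is the `a`-th literal of clause `c`, a variable together with a Boolean which is
`true` when the occurrence is non-negated. -/
def satC4DelGraph (Var Cl : Type) (lit : Cl → Fin 3 → Var × Bool) :
    SimpleGraph ((Var × Fin 6) ⊕ (Cl × Fin 6)) :=
  SimpleGraph.fromRel (fun u w =>
    match u, w with
    | Sum.inl (x, i), Sum.inl (y, j) =>
        x = y ∧ (((i : ℕ) < 3 ∧ (j : ℕ) < 3) ∨
          (((i : ℕ) = 3 ∨ (i : ℕ) = 4) ∧ ((j : ℕ) < 3 ∨ (j : ℕ) = 5)))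
    | Sum.inl (x, i), Sum.inr (c, j) =>
        (∃ a : Fin 3, lit c a = (x, true) ∧
          (((i : ℕ) = 5 ∧ (j : ℕ) = (a : ℕ)) ∨ ((i : ℕ) = 4 ∧ (j : ℕ) = (a : ℕ) + 3))) ∨
        (∃ a : Fin 3, lit c a = (x, false) ∧
          (((i : ℕ) = 5 ∧ (j : ℕ) = (a : ℕ)) ∨ ((i : ℕ) = 3 ∧ (j : ℕ) = (a : ℕ) + 3)))
    | Sum.inr (c, i), Sum.inr (d, j) =>
        c = d ∧ (((i : ℕ) < 3 ∧ (j : ℕ) < 3) ∨ (3 ≤ (i : ℕ) ∧ 3 ≤ (j : ℕ)) ∨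
          ((j : ℕ) = (i : ℕ) + 3))
    | Sum.inr _, Sum.inl _ => False)

/-- `a b c d` is an induced four-cycle of `H`. -/
structure IsInducedC4 {V : Type*} (H : SimpleGraph V) (a b c d : V) : Prop where
  ab : H.Adj a b
  bc : H.Adj b c
  cd : H.Adj c d
  da : H.Adj d a
  ac_ne : a ≠ c
  bd_ne : b ≠ d
  not_ac : ¬ H.Adj a c
  not_bd : ¬ H.Adj b d

theorem IsInducedC4.rotate {V : Type*} {H : SimpleGraph V} {a b c d : V}
    (h : IsInducedC4 H a b c d) : IsInducedC4 H b c d a :=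
  ⟨h.bc, h.cd, h.da, h.ab, h.bd_ne, h.ac_ne.symm, h.not_bd, fun e => h.not_ac e.symm⟩

theorem isEmpty_cycleGraph_four_embedding_iff {V : Type*} (H : SimpleGraph V) :
    IsEmpty (SimpleGraph.cycleGraph 4 ↪g H) ↔ ∀ a b c d, ¬ IsInducedC4 H a b c d := by
  constructor
  · rintro h a b c d ⟨ab, bc, cd, da, hac, hbd, nac, nbd⟩
    have hca : ¬ H.Adj c a := fun e => nac e.symm
    have hdb : ¬ H.Adj d b := fun e => nbd e.symm
    have key : ∀ i j, H.Adj (![a, b, c, d] i) (![a, b, c, d] j) ↔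
        (SimpleGraph.cycleGraph 4).Adj i j := by
      intro i j
      fin_cases i <;> fin_cases j <;>
        first
        | exact iff_of_false H.irrefl (by decide)
        | exact iff_of_true ab (by decide)
        | exact iff_of_true bc (by decide)
        | exact iff_of_true cd (by decide)
        | exact iff_of_true da (by decide)
        | exact iff_of_true ab.symm (by decide)
        | exact iff_of_true bc.symm (by decide)
        | exact iff_of_true cd.symm (by decide)
        | exact iff_of_true da.symm (by decide)
        | exact iff_of_false nac (by decide)
        | exact iff_of_false nbd (by decide)
        | exact iff_of_false hca (by decide)
        | exact iff_of_false hdb (by decide)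
    refine h.false ⟨⟨![a, b, c, d], ?_⟩, key _ _⟩
    intro i j hij
    fin_cases i <;> fin_cases j <;>
      simp_all [ab.ne, ab.ne', bc.ne, bc.ne', cd.ne, cd.ne', da.ne, da.ne', Ne.symm]
  · intro h
    refine ⟨fun f => h (f 0) (f 1) (f 2) (f 3) ⟨?_, ?_, ?_, ?_, ?_, ?_, ?_, ?_⟩⟩
    any_goals rw [f.map_adj_iff, cycleGraph_adj]; decide
    all_goals rw [Ne, f.injective.eq_iff]; decide

/-- If deleting `S` leaves no induced four-cycle, then `S` meets every induced four-cycle. -/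
theorem IsInducedC4.exists_edge_mem {V : Type*} {G : SimpleGraph V} {S : Set (Sym2 V)}
    (hS : ∀ a b c d, ¬ IsInducedC4 (G.deleteEdges S) a b c d) {a b c d : V}
    (h : IsInducedC4 G a b c d) : s(a, b) ∈ S ∨ s(b, c) ∈ S ∨ s(c, d) ∈ S ∨ s(d, a) ∈ S := by
  by_contra! hn
  obtain ⟨h1, h2, h3, h4⟩ := hn
  exact hS a b c d
    ⟨deleteEdges_adj.2 ⟨h.ab, h1⟩, deleteEdges_adj.2 ⟨h.bc, h2⟩, deleteEdges_adj.2 ⟨h.cd, h3⟩,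
      deleteEdges_adj.2 ⟨h.da, h4⟩, h.ac_ne, h.bd_ne, fun e => h.not_ac (deleteEdges_adj.1 e).1,
      fun e => h.not_bd (deleteEdges_adj.1 e).1⟩

/-- A graph on `P ⊕ Q` in which each vertex of `Q` has exactly one neighbour in `P` has no induced
four-cycle, provided both sides have none and the two mixed configurations are excluded. -/
theorem not_isInducedC4_of_attach {P Q : Type*} {H : SimpleGraph (P ⊕ Q)} (att : Q → P)
    (hatt : ∀ u v, H.Adj (Sum.inl u) (Sum.inr v) ↔ u = att v)
    (hP : ∀ a b c d : P, ¬ IsInducedC4 H (Sum.inl a) (Sum.inl b) (Sum.inl c) (Sum.inl d))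
    (hQ : ∀ a b c d : Q, ¬ IsInducedC4 H (Sum.inr a) (Sum.inr b) (Sum.inr c) (Sum.inr d))
    (hpath : ∀ a b c : Q, H.Adj (Sum.inr a) (Sum.inr b) → H.Adj (Sum.inr b) (Sum.inr c) →
      att a = att c → a = c)
    (hedge : ∀ a b : Q, H.Adj (Sum.inr a) (Sum.inr b) →
      ¬ H.Adj (Sum.inl (att a)) (Sum.inl (att b)))
    (a b c d : P ⊕ Q) : ¬ IsInducedC4 H a b c d := by
  have hatt' : ∀ u v, H.Adj (Sum.inr v) (Sum.inl u) ↔ u = att v := fun u v => by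
    rw [H.adj_comm, hatt]
  have hmid : ∀ (p r : P) (q : Q) (z : P ⊕ Q),
      ¬ IsInducedC4 H (Sum.inl p) (Sum.inr q) (Sum.inl r) z := by
    intro p r q z h
    exact h.ac_ne (by rw [(hatt _ _).1 h.ab, (hatt' _ _).1 h.bc])
  have hthree : ∀ (p : P) (q r s : Q),
      ¬ IsInducedC4 H (Sum.inl p) (Sum.inr q) (Sum.inr r) (Sum.inr s) := by
    intro p q r s h
    exact h.bd_ne (congrArg _ (hpath q r s h.bc h.cd
      (((hatt _ _).1 h.ab).symm.trans ((hatt' _ _).1 h.da))))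
  have htwo : ∀ (p r : P) (q s : Q),
      ¬ IsInducedC4 H (Sum.inl p) (Sum.inl r) (Sum.inr q) (Sum.inr s) := by
    intro p r q s h
    have h1 := (hatt _ _).1 h.bc
    have h2 := (hatt' _ _).1 h.da
    subst h1 h2
    exact hedge s q h.cd.symm h.ab
  intro h
  have h1 := h.rotate
  have h2 := h1.rotate
  have h3 := h2.rotate
  rcases a with a | a <;> rcases b with b | b <;> rcases c with c | c <;> rcases d with d | d <;>
    first
    | exact hP _ _ _ _ h
    | exact hQ _ _ _ _ h
    | exact hmid _ _ _ _ h
    | exact hmid _ _ _ _ h1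
    | exact hmid _ _ _ _ h2
    | exact hmid _ _ _ _ h3
    | exact hthree _ _ _ _ h
    | exact hthree _ _ _ _ h1
    | exact hthree _ _ _ _ h2
    | exact hthree _ _ _ _ h3
    | exact htwo _ _ _ _ h
    | exact htwo _ _ _ _ h1
    | exact htwo _ _ _ _ h2
    | exact htwo _ _ _ _ h3

section Gadgets

variable {Var Cl : Type} (lit : Cl → Fin 3 → Var × Bool)

/-- Adjacency inside a variable gadget. -/
abbrev varGadgetAdj (i j : Fin 6) : Prop :=
  i ≠ j ∧ ((i < 3 ∧ j < 3) ∨ ((i = 3 ∨ i = 4) ∧ (j < 3 ∨ j = 5)) ∨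
    ((j = 3 ∨ j = 4) ∧ (i < 3 ∨ i = 5)))

/-- Adjacency inside a clause gadget. -/
abbrev clauseGadgetAdj (i j : Fin 6) : Prop :=
  i ≠ j ∧ ((i < 3 ∧ j < 3) ∨ (3 ≤ i ∧ 3 ≤ j) ∨ (j : ℕ) = i + 3 ∨ (i : ℕ) = j + 3)

/-- The position in its clause of the literal to which a clause-gadget vertex belongs. -/
def litIndex : Fin 6 → Fin 3 := ![0, 1, 2, 0, 1, 2]

/-- The unique neighbour of a clause-gadget vertex among the variable gadgets. -/
def attachVertex (v : Cl × Fin 6) : Var × Fin 6 :=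
  ((lit v.1 (litIndex v.2)).1,
    if v.2 < 3 then 5 else if (lit v.1 (litIndex v.2)).2 then 4 else 3)

theorem satC4DelGraph_adj_inl_inl (x y : Var) (i j : Fin 6) :
    (satC4DelGraph Var Cl lit).Adj (Sum.inl (x, i)) (Sum.inl (y, j)) ↔
      x = y ∧ varGadgetAdj i j := by
  simp only [satC4DelGraph, fromRel_adj, ne_eq, Sum.inl.injEq, Prod.mk.injEq, varGadgetAdj,
    Fin.lt_def, Fin.ext_iff]
  by_cases h : x = y
  · subst h
    simp
    intro _
    tauto
  · simp [h, Ne.symm h]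

theorem satC4DelGraph_adj_inr_inr (c d : Cl) (i j : Fin 6) :
    (satC4DelGraph Var Cl lit).Adj (Sum.inr (c, i)) (Sum.inr (d, j)) ↔
      c = d ∧ clauseGadgetAdj i j := by
  simp only [satC4DelGraph, fromRel_adj, ne_eq, Sum.inr.injEq, Prod.mk.injEq, clauseGadgetAdj,
    Fin.lt_def, Fin.le_def, Fin.ext_iff]
  by_cases h : c = d
  · subst h
    simp
    intro _
    tauto
  · simp [h, Ne.symm h]

theorem satC4DelGraph_adj_inl_inr (u : Var × Fin 6) (v : Cl × Fin 6) :
    (satC4DelGraph Var Cl lit).Adj (Sum.inl u) (Sum.inr v) ↔ u = attachVertex lit v := by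
  obtain ⟨x, i⟩ := u
  obtain ⟨c, j⟩ := v
  simp only [satC4DelGraph, fromRel_adj, attachVertex, Prod.mk.injEq]
  have h3 : ∀ p : Fin 3 → Prop, (∃ a, p a) ↔ p 0 ∨ p 1 ∨ p 2 := by
    intro p
    simp [Fin.exists_fin_succ]
  simp only [h3]
  fin_cases j <;> simp [litIndex, Prod.ext_iff, Fin.ext_iff] <;> grind
/-- The vertex `a^c_i` of a clause gadget. -/
def aIndex : Fin 3 → Fin 6 := ![0, 1, 2]

/-- The vertex `b^c_i` of a clause gadget. -/
def bIndex : Fin 3 → Fin 6 := ![3, 4, 5]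

/-- The vertex `p^x` or `n^x` of a variable gadget, according to a sign. -/
def signIndex (s : Bool) : Fin 6 := if s then 4 else 3

theorem attachVertex_aIndex (c : Cl) (i : Fin 3) :
    attachVertex lit (c, aIndex i) = ((lit c i).1, 5) := by
  fin_cases i <;> rfl

theorem attachVertex_bIndex (c : Cl) (i : Fin 3) :
    attachVertex lit (c, bIndex i) = ((lit c i).1, signIndex (lit c i).2) := by
  fin_cases i <;> rfl

variable {lit} in
theorem attachVertex_injective (hdist : ∀ c, Function.Injective (fun a : Fin 3 => (lit c a).1))
    (c : Cl) {i j : Fin 6} (h : attachVertex lit (c, i) = attachVertex lit (c, j)) : i = j := by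
  have h1 : litIndex i = litIndex j := hdist c (congrArg (fun v : Var × Fin 6 => v.1) h)
  have h2 := congrArg Prod.snd h
  have key : ∀ (b : Bool) (i j : Fin 6), litIndex i = litIndex j →
      ((if i < 3 then 5 else if b then 4 else 3 : Fin 6) =
        if j < 3 then 5 else if b then 4 else 3) → i = j := by decide
  refine key (lit c (litIndex i)).2 i j h1 ?_
  simp only [attachVertex] at h2
  rw [← h1] at h2
  exact h2

theorem isInducedC4_varGadget (x : Var) (i : Fin 3) :
    IsInducedC4 (satC4DelGraph Var Cl lit) (Sum.inl (x, 3)) (Sum.inl (x, aIndex i))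
      (Sum.inl (x, 4)) (Sum.inl (x, 5)) := by
  constructor <;> simp only [satC4DelGraph_adj_inl_inl, ne_eq, Sum.inl.injEq, Prod.mk.injEq,
    true_and] <;> decide +revert

theorem isInducedC4_clauseGadget (c : Cl) {i j : Fin 3} (hij : i ≠ j) :
    IsInducedC4 (satC4DelGraph Var Cl lit) (Sum.inr (c, aIndex i)) (Sum.inr (c, aIndex j))
      (Sum.inr (c, bIndex j)) (Sum.inr (c, bIndex i)) := by
  constructor <;> simp only [satC4DelGraph_adj_inr_inr, ne_eq, Sum.inr.injEq, Prod.mk.injEq,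
    true_and] <;> decide +revert

theorem isInducedC4_literal (c : Cl) (i : Fin 3) :
    IsInducedC4 (satC4DelGraph Var Cl lit) (Sum.inl ((lit c i).1, 5)) (Sum.inr (c, aIndex i))
      (Sum.inr (c, bIndex i)) (Sum.inl ((lit c i).1, signIndex (lit c i).2)) := by
  have hs : ∀ b, signIndex b ≠ 5 := by decide
  constructor
  · rw [satC4DelGraph_adj_inl_inr, attachVertex_aIndex]
  · rw [satC4DelGraph_adj_inr_inr]
    exact ⟨rfl, by decide +revert⟩
  · rw [adj_comm, satC4DelGraph_adj_inl_inr, attachVertex_bIndex]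
  · rw [satC4DelGraph_adj_inl_inl]
    exact ⟨rfl, by generalize (lit c i).2 = b; decide +revert⟩
  · simp
  · simp
  · rw [satC4DelGraph_adj_inl_inr, attachVertex_bIndex]
    simpa using (hs _).symm
  · rw [adj_comm, satC4DelGraph_adj_inl_inr, attachVertex_aIndex]
    simpa using hs _

/-- Adjacency inside a variable gadget after the edge from `t` to the vertex of sign `s` is
deleted. -/
abbrev varGadgetDelAdj (s : Bool) (i j : Fin 6) : Prop :=
  varGadgetAdj i j ∧ ¬ ((i = 5 ∧ j = signIndex s) ∨ (i = signIndex s ∧ j = 5))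

/-- Adjacency inside a clause gadget after the matching edges other than the `m`-th are deleted. -/
abbrev clauseGadgetDelAdj (m : Fin 3) (i j : Fin 6) : Prop :=
  clauseGadgetAdj i j ∧
    ¬ ∃ k ≠ m, (i = aIndex k ∧ j = bIndex k) ∨ (i = bIndex k ∧ j = aIndex k)

set_option synthInstance.maxSize 2000 in
theorem varGadgetDelAdj_no_c4 : ∀ (s : Bool) (i j : Fin 6), varGadgetDelAdj s i j →
    ∀ k, varGadgetDelAdj s j k → i ≠ k → ¬ varGadgetDelAdj s i k →
    ∀ l, varGadgetDelAdj s k l → varGadgetDelAdj s l i → j ≠ l → varGadgetDelAdj s j l := by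
  decide

set_option synthInstance.maxSize 2000 in
theorem clauseGadgetDelAdj_no_c4 : ∀ (m : Fin 3) (i j : Fin 6), clauseGadgetDelAdj m i j →
    ∀ k, clauseGadgetDelAdj m j k → i ≠ k → ¬ clauseGadgetDelAdj m i k →
    ∀ l, clauseGadgetDelAdj m k l → clauseGadgetDelAdj m l i → j ≠ l →
      clauseGadgetDelAdj m j l := by
  decide

/-- The edges deleted for an assignment `α` and a choice `f` of a literal in each clause: the edge
`t^x p^x` or `t^x n^x` of each variable, and the two edges `a^c_i b^c_i` with `i ≠ f c`. -/
def assignmentEdges (α : Var → Bool) (f : Cl → Fin 3) :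
    Set (Sym2 ((Var × Fin 6) ⊕ (Cl × Fin 6))) :=
  Set.range (fun x => s(Sum.inl (x, 5), Sum.inl (x, signIndex (α x)))) ∪
    Set.range (fun p : Cl × Fin 2 => s(Sum.inr (p.1, aIndex ((f p.1).succAbove p.2)),
      Sum.inr (p.1, bIndex ((f p.1).succAbove p.2))))

theorem ncard_assignmentEdges_le [Fintype Var] [Fintype Cl] (α : Var → Bool) (f : Cl → Fin 3) :
    (assignmentEdges α f).ncard ≤ Fintype.card Var + 2 * Fintype.card Cl := by
  refine (Set.ncard_union_le _ _).trans (Nat.add_le_add ?_ ?_)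
  · rw [← Set.image_univ, ← Nat.card_eq_fintype_card, ← Set.ncard_univ]
    exact Set.ncard_image_le Set.finite_univ
  · rw [← Set.image_univ]
    refine (Set.ncard_image_le Set.finite_univ).trans ?_
    simp [Set.ncard_univ, mul_comm]

theorem assignmentEdges_subset (α : Var → Bool) (f : Cl → Fin 3) :
    assignmentEdges α f ⊆ (satC4DelGraph Var Cl lit).edgeSet := by
  rintro _ (⟨x, rfl⟩ | ⟨⟨c, k⟩, rfl⟩)
  · rw [mem_edgeSet, satC4DelGraph_adj_inl_inl]
    exact ⟨rfl, by generalize α x = b; decide +revert⟩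
  · rw [mem_edgeSet, satC4DelGraph_adj_inr_inr]
    exact ⟨rfl, by generalize (f c).succAbove k = i; decide +revert⟩

theorem inl_inl_mem_assignmentEdges (α : Var → Bool) (f : Cl → Fin 3) (x y : Var) (i j : Fin 6) :
    s(Sum.inl (x, i), Sum.inl (y, j)) ∈ assignmentEdges α f ↔
      x = y ∧ ((i = 5 ∧ j = signIndex (α x)) ∨ (i = signIndex (α x) ∧ j = 5)) := by
  simp only [assignmentEdges, Set.mem_union, Set.mem_range, Sym2.eq_iff, Sum.inl.injEq,
    Prod.mk.injEq, reduceCtorEq, and_false, or_self, exists_false, or_false]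
  grind

theorem inl_inr_not_mem_assignmentEdges (α : Var → Bool) (f : Cl → Fin 3) (u : Var × Fin 6)
    (v : Cl × Fin 6) : s(Sum.inl u, Sum.inr v) ∉ assignmentEdges α f := by
  simp [assignmentEdges]

theorem inr_inr_mem_assignmentEdges (α : Var → Bool) (f : Cl → Fin 3) (c d : Cl) (i j : Fin 6) :
    s(Sum.inr (c, i), Sum.inr (d, j)) ∈ assignmentEdges α f ↔
      c = d ∧ ∃ k ≠ f c, (i = aIndex k ∧ j = bIndex k) ∨ (i = bIndex k ∧ j = aIndex k) := by
  simp only [assignmentEdges, Set.mem_union, Set.mem_range, Sym2.eq_iff, Sum.inr.injEq,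
    Prod.mk.injEq, reduceCtorEq, false_and, or_self, exists_false, false_or, Prod.exists]
  constructor
  · rintro ⟨c, k, h⟩
    have := (f c).succAbove_ne k
    grind
  · rintro ⟨rfl, k, hk, h⟩
    obtain ⟨l, rfl⟩ := Fin.exists_succAbove_eq hk
    exact ⟨c, l, by grind⟩

/-- Deleting the edges of a satisfying assignment leaves no induced four-cycle. -/
theorem not_isInducedC4_deleteEdges_assignmentEdges
    (hdist : ∀ c, Function.Injective (fun a : Fin 3 => (lit c a).1)) (α : Var → Bool)
    (f : Cl → Fin 3) (hf : ∀ c, α (lit c (f c)).1 = (lit c (f c)).2) (a b c d) :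
    ¬ IsInducedC4 ((satC4DelGraph Var Cl lit).deleteEdges (assignmentEdges α f)) a b c d := by
  have hinl : ∀ x y i j, ((satC4DelGraph Var Cl lit).deleteEdges (assignmentEdges α f)).Adj
      (Sum.inl (x, i)) (Sum.inl (y, j)) ↔ x = y ∧ varGadgetDelAdj (α x) i j := by
    intro x y i j
    rw [deleteEdges_adj, satC4DelGraph_adj_inl_inl, inl_inl_mem_assignmentEdges]
    tauto
  have hinr : ∀ c d i j, ((satC4DelGraph Var Cl lit).deleteEdges (assignmentEdges α f)).Adj
      (Sum.inr (c, i)) (Sum.inr (d, j)) ↔ c = d ∧ clauseGadgetDelAdj (f c) i j := by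
    intro c d i j
    rw [deleteEdges_adj, satC4DelGraph_adj_inr_inr, inr_inr_mem_assignmentEdges]
    by_cases h : c = d <;> simp [h]
  refine not_isInducedC4_of_attach (attachVertex lit) ?_ ?_ ?_ ?_ ?_ a b c d
  · intro u v
    rw [deleteEdges_adj, satC4DelGraph_adj_inl_inr]
    exact and_iff_left (inl_inr_not_mem_assignmentEdges α f u v)
  · rintro ⟨x, i⟩ ⟨y, j⟩ ⟨z, k⟩ ⟨w, l⟩ ⟨h1, h2, h3, h4, h5, h6, h7, h8⟩
    rw [hinl] at h1 h2 h3 h4 h7 h8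
    obtain ⟨rfl, h1⟩ := h1
    obtain ⟨rfl, h2⟩ := h2
    obtain ⟨rfl, h3⟩ := h3
    exact h8 ⟨rfl, varGadgetDelAdj_no_c4 _ _ _ h1 _ h2 (fun e => h5 (by rw [e]))
      (fun e => h7 ⟨rfl, e⟩) _ h3 h4.2 (fun e => h6 (by rw [e]))⟩
  · rintro ⟨x, i⟩ ⟨y, j⟩ ⟨z, k⟩ ⟨w, l⟩ ⟨h1, h2, h3, h4, h5, h6, h7, h8⟩
    rw [hinr] at h1 h2 h3 h4 h7 h8
    obtain ⟨rfl, h1⟩ := h1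
    obtain ⟨rfl, h2⟩ := h2
    obtain ⟨rfl, h3⟩ := h3
    exact h8 ⟨rfl, clauseGadgetDelAdj_no_c4 _ _ _ h1 _ h2 (fun e => h5 (by rw [e]))
      (fun e => h7 ⟨rfl, e⟩) _ h3 h4.2 (fun e => h6 (by rw [e]))⟩
  · rintro ⟨x, i⟩ ⟨y, j⟩ ⟨z, k⟩ h1 h2 h
    rw [hinr] at h1 h2
    obtain ⟨rfl, -⟩ := h1
    obtain ⟨rfl, -⟩ := h2
    rw [attachVertex_injective hdist x h]
  · rintro ⟨x, i⟩ ⟨y, j⟩ h1 h2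
    obtain ⟨rfl, h1, h3⟩ := (hinr _ _ _ _).1 h1
    obtain ⟨h4, -, h5⟩ := (hinl (attachVertex lit (x, i)).1 (attachVertex lit (x, j)).1
      (attachVertex lit (x, i)).2 (attachVertex lit (x, j)).2).1 h2
    have hl : litIndex i = litIndex j := hdist x h4
    have key : ∀ i j : Fin 6, clauseGadgetAdj i j → litIndex i = litIndex j →
        ∃ k, litIndex i = k ∧ ((i = aIndex k ∧ j = bIndex k) ∨ (i = bIndex k ∧ j = aIndex k)) := by
      decide
    obtain ⟨k, -, hk⟩ := key i j h1 hl
    obtain rfl : k = f x := by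
      by_contra hne
      exact h3 ⟨k, hne, hk⟩
    apply h5
    obtain ⟨rfl, rfl⟩ | ⟨rfl, rfl⟩ := hk
    · left
      simp only [attachVertex_aIndex, attachVertex_bIndex, hf, and_self]
    · right
      simp only [attachVertex_aIndex, attachVertex_bIndex, hf, and_self]

/-- The gadget containing a vertex. -/
def gadgetOf : (Var × Fin 6) ⊕ (Cl × Fin 6) → Var ⊕ Cl := Sum.map Prod.fst Prod.fst

section Budget

variable {lit} {S : Set (Sym2 ((Var × Fin 6) ⊕ (Cl × Fin 6)))}

theorem exists_varGadget_edge_mem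
    (hS : ∀ a b c d, ¬ IsInducedC4 ((satC4DelGraph Var Cl lit).deleteEdges S) a b c d)
    (x : Var) :
    ∃ e ∈ S, e.map gadgetOf = s(Sum.inl x, Sum.inl x) := by
  obtain h | h | h | h := (isInducedC4_varGadget lit x 0).exists_edge_mem hS <;>
    exact ⟨_, h, rfl⟩

theorem exists_clauseGadget_edges_mem
    (hS : ∀ a b c d, ¬ IsInducedC4 ((satC4DelGraph Var Cl lit).deleteEdges S) a b c d)
    (c : Cl) :
    ∃ e ∈ S, ∃ e' ∈ S, e ≠ e' ∧ e.map gadgetOf = s(Sum.inr c, Sum.inr c) ∧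
      e'.map gadgetOf = s(Sum.inr c, Sum.inr c) := by
  by_contra! h
  have heq : ∀ e ∈ S, ∀ e' ∈ S, e.map gadgetOf = s(Sum.inr c, Sum.inr c) →
      e'.map gadgetOf = s(Sum.inr c, Sum.inr c) → e = e' := by
    intro e he e' he' h1 h2
    by_contra hne
    exact h e he e' he' hne h1 h2
  have hsq : ∀ i j : Fin 3, i ≠ j → ∃ e ∈ S, e.map gadgetOf = s(Sum.inr c, Sum.inr c) ∧
      ∃ p q : Fin 6, (litIndex p = i ∨ litIndex p = j) ∧ (litIndex q = i ∨ litIndex q = j) ∧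
        e = s(Sum.inr (c, p), Sum.inr (c, q)) := by
    have key : ∀ i : Fin 3, litIndex (aIndex i) = i ∧ litIndex (bIndex i) = i := by decide
    intro i j hij
    obtain h | h | h | h := (isInducedC4_clauseGadget lit c hij).exists_edge_mem hS <;>
      exact ⟨_, h, rfl, _, _, by simp [key], by simp [key], rfl⟩
  obtain ⟨e, he, heg, p, q, hp, hq, rfl⟩ := hsq 0 1 (by decide)
  obtain ⟨e', he', heg', p', q', hp', hq', rfl⟩ := hsq 1 2 (by decide)
  obtain ⟨e'', he'', heg'', p'', q'', hp'', hq'', rfl⟩ := hsq 0 2 (by decide)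
  have h1 := heq _ he _ he' heg heg'
  have h2 := heq _ he _ he'' heg heg''
  simp only [Sym2.eq_iff, Sum.inr.injEq, Prod.mk.injEq, true_and] at h1 h2
  grind

/-- Within the budget, `S` has exactly one edge in each variable gadget, exactly two in each clause
gadget and no others. -/
theorem exists_budget_edges [Fintype Var] [Fintype Cl]
    (hS : ∀ a b c d, ¬ IsInducedC4 ((satC4DelGraph Var Cl lit).deleteEdges S) a b c d)
    (hcard : S.ncard ≤ Fintype.card Var + 2 * Fintype.card Cl) :
    ∃ (ev : Var → Sym2 ((Var × Fin 6) ⊕ (Cl × Fin 6)))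
      (e₁ e₂ : Cl → Sym2 ((Var × Fin 6) ⊕ (Cl × Fin 6))),
      (∀ x, (ev x).map gadgetOf = s(Sum.inl x, Sum.inl x)) ∧
      (∀ c, (e₁ c).map gadgetOf = s(Sum.inr c, Sum.inr c)) ∧
      (∀ c, (e₂ c).map gadgetOf = s(Sum.inr c, Sum.inr c)) ∧
      ∀ e ∈ S, (∃ x, e = ev x) ∨ ∃ c, e = e₁ c ∨ e = e₂ c := by
  choose ev hev hevg using exists_varGadget_edge_mem hS
  choose e₁ he₁ e₂ he₂ hne he₁g he₂g using exists_clauseGadget_edges_mem hS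
  refine ⟨ev, e₁, e₂, hevg, he₁g, he₂g, ?_⟩
  have hinr : ∀ {c d : Cl},
      s((Sum.inr c : Var ⊕ Cl), Sum.inr c) = s(Sum.inr d, Sum.inr d) → c = d := by
    intro c d h
    simpa using h
  have hinj : Function.Injective (Sum.elim ev (Sum.elim e₁ e₂)) := by
    refine Function.Injective.sumElim ?_ (Function.Injective.sumElim ?_ ?_ ?_) ?_
    · intro x y h
      have := hevg x
      rw [h, hevg] at this
      simpa using this.symm
    · intro c d h
      exact hinr (by rw [← he₁g c, h, he₁g])
    · intro c d h
      exact hinr (by rw [← he₂g c, h, he₂g])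
    · intro c d h
      obtain rfl : c = d := hinr (by rw [← he₁g c, h, he₂g])
      exact hne c h
    · rintro x (c | c) h
      · have := hevg x
        simp [h, he₁g] at this
      · have := hevg x
        simp [h, he₂g] at this
  have hsub : Set.range (Sum.elim ev (Sum.elim e₁ e₂)) ⊆ S := by
    rintro _ ⟨x | c | c, rfl⟩
    exacts [hev x, he₁ c, he₂ c]
  have heq : Set.range (Sum.elim ev (Sum.elim e₁ e₂)) = S := by
    refine Set.eq_of_subset_of_ncard_le hsub ?_ (Set.toFinite S)
    rw [← Set.image_univ, Set.ncard_image_of_injective _ hinj, Set.ncard_univ,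
      Nat.card_eq_fintype_card, Fintype.card_sum, Fintype.card_sum]
    omega
  intro e he
  rw [← heq] at he
  obtain ⟨x | c | c, rfl⟩ := he
  exacts [Or.inl ⟨x, rfl⟩, Or.inr ⟨c, Or.inl rfl⟩, Or.inr ⟨c, Or.inr rfl⟩]

/-- A deletion set within the budget yields a satisfying assignment. -/
theorem exists_satisfying_of_deletion [Fintype Var] [Fintype Cl]
    (hS : ∀ a b c d, ¬ IsInducedC4 ((satC4DelGraph Var Cl lit).deleteEdges S) a b c d)
    (hcard : S.ncard ≤ Fintype.card Var + 2 * Fintype.card Cl) :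
    ∃ α : Var → Bool, ∀ c : Cl, ∃ a : Fin 3, α (lit c a).1 = (lit c a).2 := by
  classical
  obtain ⟨ev, e₁, e₂, hev, he₁, he₂, hmem⟩ := exists_budget_edges hS hcard
  have hvar : ∀ x, ∀ e ∈ S, e.map gadgetOf = s(Sum.inl x, Sum.inl x) → e = ev x := by
    intro x e he heg
    obtain ⟨y, rfl⟩ | ⟨c, rfl | rfl⟩ := hmem e he
    · rw [hev] at heg
      obtain rfl : y = x := by simpa using heg
      rfl
    · simp [he₁] at heg
    · simp [he₂] at heg
  have hcl : ∀ c, ∀ e ∈ S, e.map gadgetOf = s(Sum.inr c, Sum.inr c) → e = e₁ c ∨ e = e₂ c := by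
    intro c e he heg
    obtain ⟨y, rfl⟩ | ⟨d, h⟩ := hmem e he
    · simp [hev] at heg
    · obtain rfl : d = c := by
        obtain rfl | rfl := h <;> simpa [he₁, he₂] using heg
      exact h
  have hcross : ∀ u v, s(Sum.inl u, Sum.inr v) ∉ S := by
    intro u v h
    have hg : (s(Sum.inl u, Sum.inr v) : Sym2 ((Var × Fin 6) ⊕ (Cl × Fin 6))).map gadgetOf =
      s(Sum.inl u.1, Sum.inr v.1) := rfl
    obtain ⟨x, h⟩ | ⟨c, h | h⟩ := hmem _ h
    · rw [h, hev] at hg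
      simp at hg
    · rw [h, he₁] at hg
      simp at hg
    · rw [h, he₂] at hg
      simp at hg
  refine ⟨fun x => decide (s(Sum.inl (x, 4), Sum.inl (x, 5)) ∈ S), fun c => ?_⟩
  obtain ⟨a, ha⟩ : ∃ a, s(Sum.inr (c, aIndex a), Sum.inr (c, bIndex a)) ∉ S := by
    by_contra! h
    have h0 := hcl c _ (h 0) rfl
    have h1 := hcl c _ (h 1) rfl
    have h2 := hcl c _ (h 2) rfl
    have hne : ∀ i j : Fin 3, i ≠ j →
        (s(Sum.inr (c, aIndex i), Sum.inr (c, bIndex i)) : Sym2 ((Var × Fin 6) ⊕ (Cl × Fin 6))) ≠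
          s(Sum.inr (c, aIndex j), Sum.inr (c, bIndex j)) := by
      intro i j hij
      simp only [ne_eq, Sym2.eq_iff, Sum.inr.injEq, Prod.mk.injEq, true_and]
      decide +revert
    have h01 := hne 0 1 (by decide)
    have h12 := hne 1 2 (by decide)
    have h02 := hne 0 2 (by decide)
    grind
  refine ⟨a, ?_⟩
  have hdel : s(Sum.inl ((lit c a).1, signIndex (lit c a).2), Sum.inl ((lit c a).1, 5)) ∈ S := by
    obtain h | h | h | h := (isInducedC4_literal lit c a).exists_edge_mem hS
    · exact absurd h (hcross _ _)
    · exact absurd h ha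
    · rw [Sym2.eq_swap] at h
      exact absurd h (hcross _ _)
    · exact h
  generalize (lit c a).1 = x at *
  generalize (lit c a).2 = s at *
  cases s
  · rw [decide_eq_false_iff_not]
    intro h
    have := (hvar x _ h rfl).trans (hvar x _ hdel rfl).symm
    simp [signIndex] at this
  · rw [decide_eq_true_iff]
    exact hdel

end Budget

end Gadgets

/-- The 3-SAT formula `φ` (with clauses of exactly three literals on pairwise distinct
variables) is satisfiable iff at most `k_φ = |V(φ)| + 2|C(φ)|` edges can be deleted from
`G_φ` so that no induced `C₄` remains. -/
theorem satC4DelGraph_correct {Var Cl : Type} [Fintype Var] [Fintype Cl]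
    (lit : Cl → Fin 3 → Var × Bool)
    (hdist : ∀ c, Function.Injective (fun a : Fin 3 => (lit c a).1)) :
    (∃ α : Var → Bool, ∀ c : Cl, ∃ a : Fin 3, α (lit c a).1 = (lit c a).2) ↔
    (∃ S ⊆ (satC4DelGraph Var Cl lit).edgeSet,
      S.ncard ≤ Fintype.card Var + 2 * Fintype.card Cl ∧
      IsEmpty (SimpleGraph.cycleGraph 4 ↪g ((satC4DelGraph Var Cl lit).deleteEdges S))) := by
  constructor
  · rintro ⟨α, hα⟩
    choose f hf using hα
    exact ⟨assignmentEdges α f, assignmentEdges_subset lit α f, ncard_assignmentEdges_le α f,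
      (isEmpty_cycleGraph_four_embedding_iff _).2
        (not_isInducedC4_deleteEdges_assignmentEdges lit hdist α f hf)⟩
  · rintro ⟨S, -, hcard, hS⟩
    exact exists_satisfying_of_deletion ((isEmpty_cycleGraph_four_embedding_iff _).1 hS) hcard
end
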